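/- Let q be an odd prime and k ≥ 1 a natural number. Let S = {s_1, …, s_ℓ} be a set of exactly ℓ = q^k + q^{k−1} + … + q + 1 distinct nonzero integers, none of which is a perfect q-th power, and suppose S belongs to 𝒯_{k,q}. Then for every choice of k+1 distinct primes p̄_1, …, p̄_{k+1}, the set S is geometrically q-equivalent to S̄ = ⋃_{i=1}^{k+1} { p̄_i · ∏_{j=i+1}^{k+1} p̄_j^{α_j} : α_{i+1}, …, α_{k+1} ∈ {0, 1, …, q−1} }. -/

import Mathlib

open Finset

/-- `S ∈ 𝒯_{k,q}`: there is a positive integer `Δ` such that for every natural number `N`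
with `Ω(N) ≤ k` and `gcd(N, Δ) = 1`, some `s ∈ S` is a `q`-th power modulo `N`. -/
def MemT (q k : ℕ) (S : Set ℤ) : Prop :=
  ∃ Δ : ℕ, 0 < Δ ∧ ∀ N : ℕ, 0 < N → N.primeFactorsList.length ≤ k → Nat.Coprime N Δ →
    ∃ s ∈ S, ∃ x : ℤ, (N : ℤ) ∣ x ^ q - s

/-- `s` is a perfect `q`-th power of an integer. -/
def IsPerfectPow (q : ℕ) (s : ℤ) : Prop := ∃ r : ℤ, r ^ q = s

/-- The finite set of primes dividing `∏_{s ∈ S} rad_q(|s|)`, i.e. the primes `p` such that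
`q ∤ v_p(|s|)` for some `s ∈ S`. -/
def qPrimes (q : ℕ) (S : Finset ℤ) : Finset ℕ :=
  S.sup fun s => s.natAbs.primeFactors.filter fun p => ¬ q ∣ s.natAbs.factorization p

/-- The vector `(v_{p_1}(|u|) mod q, …, v_{p_n}(|u|) mod q)` where `p_1 < … < p_n`
is the increasing enumeration of the finite set of primes `P`. -/
def vecOf (q : ℕ) (P : Finset ℕ) (u : ℤ) : Fin P.card → ZMod q :=
  fun i => ((u.natAbs.factorization (P.orderIsoOfFin rfl i).1 : ℕ) : ZMod q)

/-- The projective point `⟨v⟩` of `PG(F_q^n)` spanned by a vector `v`. -/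
def projPoint {q n : ℕ} (v : Fin n → ZMod q) : Submodule (ZMod q) (Fin n → ZMod q) :=
  Submodule.span (ZMod q) {v}

/-- The set of projective points associated with `S` in `PG(F_q^n)`,
`n` being the number of distinct primes dividing `∏_{s ∈ S} rad_q(|s|)`. -/
def assocPoints (q : ℕ) (S : Finset ℤ) :
    Set (Submodule (ZMod q) (Fin (qPrimes q S).card → ZMod q)) :=
  {P | ∃ s ∈ S, P = projPoint (vecOf q (qPrimes q S) s)}

/-- `B` is a `k`-blocking set of `PG(F_q^n)`: every subspace of codimension `k`
contains a nonzero vector spanning a point of `B`. -/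
def IsBlockingSet (q n k : ℕ) (B : Set (Submodule (ZMod q) (Fin n → ZMod q))) : Prop :=
  ∀ W : Submodule (ZMod q) (Fin n → ZMod q), Module.finrank (ZMod q) W = n - k →
    ∃ v ∈ W, v ≠ 0 ∧ projPoint v ∈ B

/-- `B` is (the point set of) a `k`-space of `PG(F_q^n)`. -/
def IsKSpace (q n k : ℕ) (B : Set (Submodule (ZMod q) (Fin n → ZMod q))) : Prop :=
  ∃ W : Submodule (ZMod q) (Fin n → ZMod q), Module.finrank (ZMod q) W = k + 1 ∧
    B = {P | ∃ v ∈ W, v ≠ 0 ∧ P = projPoint v}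

/-- `S` and `T` are geometrically `q`-equivalent: some element of `PGL(n, q)` maps the point set
associated with `S` onto the point set associated with `T`, where the points are computed with
respect to all the primes dividing `(∏_{s ∈ S} rad_q(|s|)) ⬝ (∏_{t ∈ T} rad_q(|t|))`. -/
def GeomEquiv (q : ℕ) (S T : Finset ℤ) : Prop :=
  ∃ Ψ : (Fin (qPrimes q (S ∪ T)).card → ZMod q) ≃ₗ[ZMod q]
        (Fin (qPrimes q (S ∪ T)).card → ZMod q),
    (Submodule.map Ψ.toLinearMap) ''
        {P | ∃ s ∈ S, P = projPoint (vecOf q (qPrimes q (S ∪ T)) s)} =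
      {P | ∃ t ∈ T, P = projPoint (vecOf q (qPrimes q (S ∪ T)) t)}

/-- The set of squares of `F_qˣ` together with `0`. -/
def Q0 (q : ℕ) : Set (ZMod q) := {x | (∃ a : ZMod q, a ≠ 0 ∧ a ^ 2 = x) ∨ x = 0}
/-- The standard minimum-size set
`S̄ = ⋃_{i=1}^{k+1} { p̄_i ∏_{j>i} p̄_j^{α_j} : α_j ∈ {0, …, q-1} }`. -/
def standardSet (q k : ℕ) (pbar : Fin (k + 1) → ℕ) : Finset ℤ :=
  Finset.image
    (fun x : Fin (k + 1) × (Fin (k + 1) → Fin q) =>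
      (pbar x.1 : ℤ) *
        ∏ j ∈ Finset.univ.filter (fun j => x.1 < j), (pbar j : ℤ) ^ (x.2 j : ℕ))
    Finset.univ


section BB
variable {q : ℕ} [hqf : Fact q.Prime] {ι : Type*} [DecidableEq ι] {V : Type*} [AddCommGroup V] [Module (ZMod q) V]

lemma bb_card_ker [Finite V] (v : V) (hv : v ≠ 0) [Fintype (Module.Dual (ZMod q) V)] :
    q * #{f : Module.Dual (ZMod q) V | f v = 0} = Fintype.card (Module.Dual (ZMod q) V) := by
  classical
  let E : Module.Dual (ZMod q) V →ₗ[ZMod q] ZMod q := Module.Dual.eval (ZMod q) V v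
  have hsurj : Function.Surjective E := by
    apply LinearMap.surjective
    intro h
    exact hv ((Module.forall_dual_apply_eq_zero_iff (ZMod q) v).1 fun f => LinearMap.congr_fun h f)
  have h1 := Submodule.card_eq_card_quotient_mul_card (LinearMap.ker E)
  have h2 : Nat.card (Module.Dual (ZMod q) V ⧸ LinearMap.ker E) = q := by
    rw [Nat.card_congr (E.quotKerEquivOfSurjective hsurj).toEquiv, Nat.card_zmod]
  have h3 : Nat.card (LinearMap.ker E) = #{f : Module.Dual (ZMod q) V | f v = 0} := by
    rw [Nat.card_eq_fintype_card, Fintype.card_subtype]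
    congr 1
    ext f
    simp [E]
  rw [h2, h3, Nat.card_eq_fintype_card] at h1
  rw [h1, mul_comm]

lemma bb_lower [Finite V] (u : ι → V) : ∀ (k : ℕ) (S : Finset ι), (∀ s ∈ S, u s ≠ 0) →
    #S < ∑ i ∈ Finset.range (k + 1), q ^ i →
    ∃ fs : List (Module.Dual (ZMod q) V), fs.length ≤ k ∧ ∀ s ∈ S, ∃ f ∈ fs, f (u s) ≠ 0 := by
  intro k
  induction k with
  | zero =>
    intro S hS hc
    refine ⟨[], by simp, ?_⟩
    have : S = ∅ := by simpa using hc
    simp [this]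
  | succ k ih =>
    intro S hS hc
    classical
    have : Finite (Module.Dual (ZMod q) V) := Module.finite_of_finite (ZMod q)
    let _ : Fintype (Module.Dual (ZMod q) V) := Fintype.ofFinite _
    set t := ∑ i ∈ Finset.range (k + 1), q ^ i with ht
    have htpos : 0 < t := by
      rw [ht, Finset.sum_range_succ']; simp
    have hq2 : 2 ≤ q := hqf.out.two_le
    have hc' : #S ≤ q * t := by
      rw [Finset.sum_range_succ'] at hc
      have : ∑ i ∈ Finset.range (k + 1), q ^ (i + 1) = q * t := by
        rw [ht, Finset.mul_sum]; exact Finset.sum_congr rfl fun i _ => by ring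
      rw [this] at hc; simp at hc; omega
    obtain ⟨f, hf⟩ : ∃ f : Module.Dual (ZMod q) V, #{s ∈ S | f (u s) = 0} < t := by
      by_contra! hcon
      have hsum : ∑ f : Module.Dual (ZMod q) V, q * #{s ∈ S | f (u s) = 0} =
          #S * Fintype.card (Module.Dual (ZMod q) V) := by
        rw [← Finset.mul_sum]
        have : ∑ f : Module.Dual (ZMod q) V, #{s ∈ S | f (u s) = 0} =
            ∑ s ∈ S, #{f : Module.Dual (ZMod q) V | f (u s) = 0} := by
          simp_rw [Finset.card_filter]
          rw [Finset.sum_comm]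
        rw [this, Finset.mul_sum, Finset.sum_congr rfl fun s hs => bb_card_ker (u s) (hS s hs)]
        simp
      have hD : 0 < Fintype.card (Module.Dual (ZMod q) V) := Fintype.card_pos
      have hge : ∑ f : Module.Dual (ZMod q) V, q * t ≤
          ∑ f : Module.Dual (ZMod q) V, q * #{s ∈ S | f (u s) = 0} :=
        Finset.sum_le_sum fun f _ => Nat.mul_le_mul_left _ (hcon f)
      have hconst : ∑ f : Module.Dual (ZMod q) V, q * t =
          q * t * Fintype.card (Module.Dual (ZMod q) V) := by
        simp [mul_comm]
      have h1 : q * t ≤ #S := by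
        rw [hsum, hconst] at hge
        exact Nat.le_of_mul_le_mul_right hge hD
      have hlt : ∑ f : Module.Dual (ZMod q) V, q * t <
          ∑ f : Module.Dual (ZMod q) V, q * #{s ∈ S | f (u s) = 0} := by
        refine Finset.sum_lt_sum (fun f _ => Nat.mul_le_mul_left _ (hcon f)) ⟨0, by simp, ?_⟩
        have : #{s ∈ S | (0 : Module.Dual (ZMod q) V) (u s) = 0} = #S := by simp
        rw [this]
        nlinarith
      rw [hsum, hconst] at hlt
      have := Nat.lt_of_mul_lt_mul_right hlt
      omega
    obtain ⟨fs, hl, hfs⟩ := ih {s ∈ S | f (u s) = 0}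
      (fun s hs => hS s (Finset.mem_filter.1 hs).1) hf
    refine ⟨f :: fs, by simpa using hl, fun s hs => ?_⟩
    by_cases h0 : f (u s) = 0
    · obtain ⟨f', hf', h'⟩ := hfs s (Finset.mem_filter.2 ⟨hs, h0⟩)
      exact ⟨f', by simp [hf'], h'⟩
    · exact ⟨f, by simp, h0⟩

lemma bb_indep [Finite V] (u : ι → V) (k : ℕ) (S : Finset ι) (hS : ∀ s ∈ S, u s ≠ 0)
    (hc : #S = ∑ i ∈ Finset.range (k + 1), q ^ i)
    (hb : ∀ fs : List (Module.Dual (ZMod q) V), fs.length ≤ k → ∃ s ∈ S, ∀ f ∈ fs, f (u s) = 0)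
    (s s' : ι) (hs : s ∈ S) (hs' : s' ∈ S) (hne : s ≠ s') (c : ZMod q) (h : u s = c • u s') :
    False := by
  have hlt : #(S.erase s) < ∑ i ∈ Finset.range (k + 1), q ^ i := by
    rw [← hc]; exact Finset.card_erase_lt_of_mem hs
  obtain ⟨fs, hl, hfs⟩ := bb_lower u k (S.erase s)
    (fun t ht => hS t (Finset.mem_of_mem_erase ht)) hlt
  obtain ⟨t, ht, ht0⟩ := hb fs hl
  by_cases hts : t = s
  · subst hts
    obtain ⟨f, hf, hf0⟩ := hfs s' (Finset.mem_erase.2 ⟨hne.symm, hs'⟩)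
    have := ht0 f hf
    rw [h, map_smul, smul_eq_mul, mul_eq_zero] at this
    rcases this with h0 | h0
    · exact hS t ht (by rw [h, h0, zero_smul])
    · exact hf0 h0
  · obtain ⟨f, hf, hf0⟩ := hfs t (Finset.mem_erase.2 ⟨hts, ht⟩)
    exact hf0 (ht0 f hf)

lemma bb_line [Finite V] (u : ι → V) (k : ℕ) (S : Finset ι) (hS : ∀ s ∈ S, u s ≠ 0)
    (hc : #S = ∑ i ∈ Finset.range (k + 1), q ^ i)
    (hb : ∀ fs : List (Module.Dual (ZMod q) V), fs.length ≤ k → ∃ s ∈ S, ∀ f ∈ fs, f (u s) = 0)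
    (s s' : ι) (hs : s ∈ S) (hs' : s' ∈ S) (hne : s ≠ s') (a b : ZMod q) (ha : a ≠ 0) :
    ∃ t ∈ S, ∃ c : ZMod q, u t = c • (a • u s + b • u s') := by
  by_contra! hcon
  set w := a • u s + b • u s' with hw
  let Q := V ⧸ (Submodule.span (ZMod q) {w})
  let π : V →ₗ[ZMod q] Q := Submodule.mkQ _
  have : Finite Q := Finite.of_surjective π (Submodule.mkQ_surjective _)
  refine bb_indep (V := Q) (fun i => π (u i)) k S ?_ hc ?_ s s' hs hs' hne (-(a⁻¹ * b)) ?_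
  · intro t ht h0
    have h1 := (Submodule.Quotient.mk_eq_zero _).1 h0
    obtain ⟨c, hc⟩ := Submodule.mem_span_singleton.1 h1
    exact hcon t ht c hc.symm
  · intro fs hl
    obtain ⟨t, ht, h0⟩ := hb (fs.map fun f => f.comp π) (by simpa using hl)
    refine ⟨t, ht, fun f hf => ?_⟩
    exact h0 (f.comp π) (List.mem_map.2 ⟨f, hf, rfl⟩)
  · have hw0 : π w = 0 :=
      (Submodule.Quotient.mk_eq_zero _).2 (Submodule.mem_span_singleton_self w)
    replace hw0 : a • π (u s) + b • π (u s') = 0 := by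
      rw [← map_smul, ← map_smul, ← map_add]; exact hw0
    have : a⁻¹ • (a • π (u s) + b • π (u s')) = 0 := by rw [hw0, smul_zero]
    rw [smul_add, smul_smul, smul_smul, inv_mul_cancel₀ ha, one_smul] at this
    rw [neg_smul]
    exact eq_neg_of_add_eq_zero_left this

lemma bb_main [Finite V] (u : ι → V) (k : ℕ) (S : Finset ι) (hS : ∀ s ∈ S, u s ≠ 0)
    (hc : #S = ∑ i ∈ Finset.range (k + 1), q ^ i)
    (hb : ∀ fs : List (Module.Dual (ZMod q) V), fs.length ≤ k → ∃ s ∈ S, ∀ f ∈ fs, f (u s) = 0) :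
    ∃ U : Submodule (ZMod q) V, Module.finrank (ZMod q) U = k + 1 ∧
      (∀ s ∈ S, u s ∈ U) ∧ ∀ w ∈ U, w ≠ 0 → ∃ s ∈ S, ∃ c : ZMod q, c ≠ 0 ∧ w = c • u s := by
  classical
  obtain ⟨s0, hs0, -⟩ := hb [] (by simp)
  let U : Submodule (ZMod q) V :=
    { carrier := {w | ∃ s ∈ S, ∃ c : ZMod q, w = c • u s}
      zero_mem' := ⟨s0, hs0, 0, by simp⟩
      smul_mem' := by
        rintro c w ⟨s, hs, d, rfl⟩
        exact ⟨s, hs, c * d, by rw [smul_smul]⟩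
      add_mem' := by
        rintro w w' ⟨s, hs, a, rfl⟩ ⟨s', hs', b, rfl⟩
        by_cases hne : s = s'
        · subst hne
          exact ⟨s, hs, a + b, by rw [add_smul]⟩
        by_cases ha : a = 0
        · exact ⟨s', hs', b, by simp [ha]⟩
        obtain ⟨t, ht, c, hct⟩ := bb_line u k S hS hc hb s s' hs hs' hne a b ha
        have hc0 : c ≠ 0 := by
          rintro rfl
          exact hS t ht (by rw [hct, zero_smul])
        exact ⟨t, ht, c⁻¹, by rw [hct, smul_smul, inv_mul_cancel₀ hc0, one_smul]⟩ }
  have hmem : ∀ w, w ∈ U ↔ ∃ s ∈ S, ∃ c : ZMod q, w = c • u s := fun w => Iff.rfl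
  refine ⟨U, ?_, fun s hs => (hmem _).2 ⟨s, hs, 1, by simp⟩, ?_⟩
  · let A : Finset V := insert 0
      ((((Finset.univ : Finset (ZMod q)).erase 0) ×ˢ S).image fun x => x.1 • u x.2)
    have hA : ∀ w, w ∈ U ↔ w ∈ A := by
      intro w
      simp only [hmem, A, Finset.mem_insert, Finset.mem_image, Finset.mem_product,
        Finset.mem_erase, Finset.mem_univ, and_true, Prod.exists]
      constructor
      · rintro ⟨s, hs, c, rfl⟩
        by_cases h : c = 0
        · simp [h]
        · exact Or.inr ⟨c, s, ⟨h, hs⟩, rfl⟩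
      · rintro (rfl | ⟨c, s, ⟨h, hs⟩, rfl⟩)
        · exact ⟨s0, hs0, 0, by simp⟩
        · exact ⟨s, hs, c, rfl⟩
    have hcardA : #A = (q - 1) * #S + 1 := by
      rw [Finset.card_insert_of_notMem, Finset.card_image_of_injOn, Finset.card_product,
        Finset.card_erase_of_mem (Finset.mem_univ _), Finset.card_univ, ZMod.card]
      · rintro ⟨c, s⟩ h ⟨c', s'⟩ h' heq
        simp only [Finset.coe_product, Set.mem_prod, Finset.mem_coe, Finset.mem_erase,
          Finset.mem_univ, and_true] at h h' heq
        have hss : s = s' := by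
          by_contra hne
          refine bb_indep u k S hS hc hb s s' h.2 h'.2 hne (c⁻¹ * c') ?_
          rw [← smul_smul, ← heq, smul_smul, inv_mul_cancel₀ h.1, one_smul]
        subst hss
        have : (c - c') • u s = 0 := by rw [sub_smul, heq, sub_self]
        rcases smul_eq_zero.1 this with h0 | h0
        · rw [sub_eq_zero.1 h0]
        · exact absurd h0 (hS s h.2)
      · simp only [Finset.mem_image, Finset.mem_product, Finset.mem_erase, Finset.mem_univ,
          and_true, Prod.exists, not_exists, not_and]
        rintro c s ⟨h, hs⟩ h0
        rcases smul_eq_zero.1 h0 with h0 | h0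
        · exact h h0
        · exact hS s hs h0
    have h1 : Nat.card U = q ^ Module.finrank (ZMod q) U := by
      rw [Module.natCard_eq_pow_finrank (K := ZMod q), Nat.card_zmod]
    have h2 : Nat.card U = #A := by
      rw [Nat.card_congr (Equiv.subtypeEquivRight hA)]
      simp
    have h3 : (q - 1) * #S + 1 = q ^ (k + 1) := by
      rw [hc, mul_comm]
      have hq1 : 1 ≤ q := hqf.out.one_lt.le
      obtain ⟨m, rfl⟩ : ∃ m, q = m + 1 := ⟨q - 1, by omega⟩
      have := geom_sum_mul_add m (k + 1)
      simpa using this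
    rw [h2, hcardA, h3] at h1
    exact (Nat.pow_right_injective hqf.out.two_le h1).symm
  · intro w hw hw0
    obtain ⟨s, hs, c, rfl⟩ := (hmem w).1 hw
    exact ⟨s, hs, c, fun h => hw0 (by simp [h]), rfl⟩
end BB


section Euler
open scoped ENNReal
variable {R : Type*} [CommRing R] [IsDedekindDomain R]

/-- Nonzero ideals all of whose prime factors lie in `F`. -/
def smoothIdeals (F : Finset (Ideal R)) : Set (Ideal R) :=
  {I | I ≠ 0 ∧ ∀ P : Ideal R, Prime P → P ∣ I → P ∈ F}

lemma euler_smooth (w : Ideal R →* ℝ≥0∞) (F : Finset (Ideal R)) (hF : ∀ P ∈ F, Prime P) :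
    ∑' I : smoothIdeals F, w I = ∏ P ∈ F, (1 - w P)⁻¹ := by
  classical
  induction F using Finset.induction_on with
  | empty =>
    have : smoothIdeals (∅ : Finset (Ideal R)) = {1} := by
      ext I
      simp only [smoothIdeals, Set.mem_setOf_eq, Set.mem_singleton_iff]
      constructor
      · rintro ⟨h0, h⟩
        by_contra h1
        obtain ⟨P, hP, hd⟩ := WfDvdMonoid.exists_irreducible_factor
          (fun hu => h1 (by simpa using hu)) h0
        exact absurd (h P hP.prime hd) (by simp)
      · rintro rfl
        exact ⟨one_ne_zero, fun P hP hd => absurd (isUnit_of_dvd_one hd) hP.not_unit⟩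
    rw [this, tsum_singleton (1 : Ideal R) (fun I => w I), map_one]
    rfl
  | insert P F hPF ih =>
    have hP : Prime P := hF P (by simp)
    have ih' := ih fun Q hQ => hF Q (by simp [hQ])
    rw [Finset.prod_insert hPF, ← ih', ← ENNReal.tsum_geometric, ← ENNReal.tsum_mul_right]
    simp_rw [← ENNReal.tsum_mul_left]
    rw [← ENNReal.tsum_prod]
    have hnd : ∀ J ∈ smoothIdeals F, ¬ P ∣ J := fun J hJ hd => hPF (hJ.2 P hP hd)
    let e : ℕ × smoothIdeals F → smoothIdeals (insert P F) := fun x =>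
      ⟨P ^ x.1 * x.2.1, mul_ne_zero (pow_ne_zero _ hP.ne_zero) x.2.2.1, by
        intro Q hQ hd
        rcases hQ.dvd_or_dvd hd with h | h
        · have := hQ.dvd_of_dvd_pow h
          rw [Finset.mem_insert]; left
          exact associated_iff_eq.1 (hQ.associated_of_dvd hP this)
        · rw [Finset.mem_insert]; right
          exact x.2.2.2 Q hQ h⟩
    have he : Function.Bijective e := by
      constructor
      · rintro ⟨n, J, hJ⟩ ⟨m, J', hJ'⟩ h
        have h' : P ^ n * J = P ^ m * J' := congrArg Subtype.val h
        have key : ∀ (n m : ℕ) (J J' : Ideal R), ¬ P ∣ J → P ^ n * J = P ^ m * J' → m ≤ n := by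
          intro n m J J' hJ h
          by_contra! hlt
          obtain ⟨d, rfl⟩ := Nat.exists_eq_add_of_lt hlt
          rw [add_assoc, pow_add, mul_assoc] at h
          have := mul_left_cancel₀ (pow_ne_zero _ hP.ne_zero) h
          exact hJ (this ▸ Dvd.dvd.mul_right (dvd_pow_self P (by omega)) _)
        have hnm : n = m := le_antisymm (key _ _ _ _ (hnd J' hJ') h'.symm) (key _ _ _ _ (hnd J hJ) h')
        subst hnm
        have := mul_left_cancel₀ (pow_ne_zero _ hP.ne_zero) h'
        subst this
        rfl
      · rintro ⟨I, hI0, hI⟩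
        have hfin : FiniteMultiplicity P I :=
          FiniteMultiplicity.of_prime_left hP hI0
        obtain ⟨J, hJ, hPJ⟩ := hfin.exists_eq_pow_mul_and_not_dvd
        refine ⟨(multiplicity P I, ⟨J, ?_, ?_⟩), Subtype.ext hJ.symm⟩
        · rintro rfl
          exact hPJ (dvd_zero _)
        · intro Q hQ hd
          have := hI Q hQ (hJ ▸ Dvd.dvd.mul_left hd _)
          rcases Finset.mem_insert.1 this with rfl | h
          · exact absurd hd hPJ
          · exact h
    rw [← (Equiv.ofBijective e he).tsum_eq]
    refine tsum_congr fun x => ?_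
    simp [e]

lemma euler_le (w : Ideal R →* ℝ≥0∞) (F : Finset (Ideal R)) (hF : ∀ P ∈ F, Prime P) :
    ∏ P ∈ F, (1 - w P)⁻¹ ≤ ∑' I, w I := by
  rw [← euler_smooth w F hF]
  exact ENNReal.tsum_comp_le_tsum_of_injective Subtype.val_injective w

lemma le_euler (w : Ideal R →* ℝ≥0∞) (hw : w 0 = 0) (B : ℝ≥0∞)
    (h : ∀ F : Finset (Ideal R), (∀ P ∈ F, Prime P) → ∏ P ∈ F, (1 - w P)⁻¹ ≤ B) :
    ∑' I, w I ≤ B := by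
  classical
  rw [ENNReal.tsum_eq_iSup_sum]
  refine iSup_le fun T => ?_
  let F : Finset (Ideal R) := T.biUnion fun I =>
    (UniqueFactorizationMonoid.normalizedFactors I).toFinset
  have hF : ∀ P ∈ F, Prime P := by
    intro P hP
    obtain ⟨I, -, hI⟩ := Finset.mem_biUnion.1 hP
    exact UniqueFactorizationMonoid.prime_of_normalized_factor P (Multiset.mem_toFinset.1 hI)
  refine le_trans ?_ (h F hF)
  rw [← euler_smooth w F hF]
  rw [tsum_subtype (smoothIdeals F) (fun I => w I)]
  refine le_trans (Finset.sum_le_sum (g := (smoothIdeals F).indicator fun I => w I) ?_)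
    (ENNReal.sum_le_tsum T)
  intro I hI
  by_cases h0 : I = 0
  · subst h0; rw [hw]; exact zero_le
  · rw [Set.indicator_of_mem]
    refine ⟨h0, fun P hP hd => Finset.mem_biUnion.2 ⟨I, hI, Multiset.mem_toFinset.2 ?_⟩⟩
    obtain ⟨Q, hQ, hPQ⟩ := UniqueFactorizationMonoid.exists_mem_normalizedFactors_of_dvd h0
      hP.irreducible hd
    rwa [associated_iff_eq.1 hPQ]

/-- comparison of Euler products -/
lemma euler_compare {R' : Type*} [CommRing R'] [IsDedekindDomain R'] (q : ℕ)
    (w : Ideal R →* ℝ≥0∞) (hw : w 0 = 0) (w' : Ideal R' →* ℝ≥0∞)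
    (hhalf : ∀ P, Prime P → w P ≤ 2⁻¹)
    (bad : Finset (Ideal R))
    (ov : Ideal R → Finset (Ideal R'))
    (hprime : ∀ P, Prime P → P ∉ bad → ∀ Q ∈ ov P, Prime Q)
    (hcard : ∀ P, Prime P → P ∉ bad → #(ov P) = q)
    (hw' : ∀ P, Prime P → P ∉ bad → ∀ Q ∈ ov P, w' Q = w P)
    (hdisj : ∀ P P', Prime P → P ∉ bad → Prime P' → P' ∉ bad → ∀ Q ∈ ov P, Q ∈ ov P' → P = P') :
    (∑' I, w I) ^ q ≤ 2 ^ (q * #bad) * ∑' I, w' I := by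
  classical
  rcases Nat.eq_zero_or_pos q with rfl | hq
  · have h1 := euler_le w' ∅ (by simp)
    simpa using h1
  have hq0 : q ≠ 0 := hq.ne'
  set B := (2 ^ (q * #bad) * ∑' I, w' I : ℝ≥0∞) with hB
  have main : ∑' I, w I ≤ B ^ ((q : ℝ)⁻¹) := by
    apply le_euler w hw
    intro F hF
    rw [ENNReal.le_rpow_inv_iff (by positivity), ENNReal.rpow_natCast]
    rw [← Finset.prod_filter_mul_prod_filter_not F (fun P => P ∈ bad), mul_pow]
    apply mul_le_mul'
    · rw [mul_comm q, pow_mul]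
      gcongr
      have h2 : ∀ P ∈ F, (1 - w P)⁻¹ ≤ 2 := by
        intro P hP
        rw [ENNReal.inv_le_iff_inv_le]
        have := hhalf P (hF P hP)
        calc (2 : ℝ≥0∞)⁻¹ = 1 - 2⁻¹ := by rw [ENNReal.one_sub_inv_two]
          _ ≤ 1 - w P := tsub_le_tsub_left this 1
      calc ∏ P ∈ F with P ∈ bad, (1 - w P)⁻¹ ≤ ∏ P ∈ F with P ∈ bad, 2 :=
            Finset.prod_le_prod' fun P hP => h2 P (Finset.mem_filter.1 hP).1
        _ = 2 ^ #{P ∈ F | P ∈ bad} := by simp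
        _ ≤ 2 ^ #bad := by
            apply pow_le_pow_right₀ (by norm_num)
            exact Finset.card_le_card fun P hP => (Finset.mem_filter.1 hP).2
    · refine le_trans (le_of_eq ?_) (euler_le w' ({P ∈ F | P ∉ bad}.biUnion ov) ?_)
      · rw [Finset.prod_biUnion]
        · rw [← Finset.prod_pow]
          refine Finset.prod_congr rfl fun P hP => ?_
          obtain ⟨hPF, hPb⟩ := Finset.mem_filter.1 hP
          rw [Finset.prod_congr rfl fun Q hQ => by rw [hw' P (hF P hPF) hPb Q hQ]]
          rw [Finset.prod_const, hcard P (hF P hPF) hPb]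
        · intro P hP P' hP' hne
          obtain ⟨hPF, hPb⟩ := Finset.mem_filter.1 hP
          obtain ⟨hPF', hPb'⟩ := Finset.mem_filter.1 hP'
          refine Finset.disjoint_left.2 fun Q hQ hQ' => hne ?_
          exact hdisj P P' (hF P hPF) hPb (hF P' hPF') hPb' Q hQ hQ'
      · intro Q hQ
        obtain ⟨P, hP, hQP⟩ := Finset.mem_biUnion.1 hQ
        obtain ⟨hPF, hPb⟩ := Finset.mem_filter.1 hP
        exact hprime P (hF P hPF) hPb Q hQP
  rwa [ENNReal.le_rpow_inv_iff (by positivity), ENNReal.rpow_natCast] at main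
end Euler


section Zeta
open scoped ENNReal Topology NumberField
open Filter
variable (K : Type*) [Field K] [NumberField K]

/-- The weight `N(I)^{-s}` as a multiplicative function on ideals. -/
noncomputable def idealW (s : ℝ) : Ideal (𝓞 K) →* ℝ≥0∞ where
  toFun I := ENNReal.ofReal ((Ideal.absNorm I : ℝ) ^ (-s))
  map_one' := by simp
  map_mul' I J := by
    rw [← ENNReal.ofReal_mul (by positivity), map_mul, Nat.cast_mul,
      Real.mul_rpow (by positivity) (by positivity)]

lemma idealW_apply (s : ℝ) (I : Ideal (𝓞 K)) :
    idealW K s I = ENNReal.ofReal ((Ideal.absNorm I : ℝ) ^ (-s)) := rfl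

lemma idealW_half {s : ℝ} (hs : 1 < s) (P : Ideal (𝓞 K)) (hP : Prime P) : idealW K s P ≤ 2⁻¹ := by
  have h2 : 2 ≤ Ideal.absNorm P := by
    have h0 : Ideal.absNorm P ≠ 0 := by
      intro h; exact hP.ne_zero (Ideal.absNorm_eq_zero_iff.1 h)
    have h1 : Ideal.absNorm P ≠ 1 := by
      intro h; exact hP.not_unit (by exact Ideal.isUnit_iff.2 (Ideal.absNorm_eq_one_iff.1 h))
    omega
  have h2' : (2 : ℝ) ≤ Ideal.absNorm P := by exact_mod_cast h2
  rw [idealW_apply]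
  have : (2 : ℝ≥0∞)⁻¹ = ENNReal.ofReal (2⁻¹) := by
    rw [ENNReal.ofReal_inv_of_pos (by norm_num)]; simp
  rw [this]
  apply ENNReal.ofReal_le_ofReal
  rw [Real.rpow_neg (by positivity)]
  apply inv_anti₀ (by norm_num)
  calc (2 : ℝ) ≤ Ideal.absNorm P := h2'
    _ = (Ideal.absNorm P : ℝ) ^ (1 : ℝ) := by simp
    _ ≤ _ := Real.rpow_le_rpow_of_exponent_le (by linarith) hs.le

lemma zeta_ev : ∃ Z : ℝ → ℝ, Tendsto (fun s => (s - 1) * Z s) (𝓝[>] 1)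
      (𝓝 (NumberField.dedekindZeta_residue K)) ∧
    ∀ᶠ s in 𝓝[>] (1 : ℝ), ∑' I, idealW K s I = ENNReal.ofReal (Z s) ∧ 0 ≤ Z s := by
  let a : ℕ → ℕ := fun n => Nat.card {I : Ideal (𝓞 K) // Ideal.absNorm I = n}
  let T : ℝ → ℕ → ℝ := fun s n => if n = 0 then 0 else (a n : ℝ) * (n : ℝ) ^ (-s)
  have hT0 : ∀ s n, 0 ≤ T s n := by
    intro s n
    simp only [T]; split_ifs
    · exact le_rfl
    · positivity
  have hterm : ∀ (s : ℝ) n, LSeries.term (fun n => (a n : ℂ)) (s : ℂ) n = ((T s n : ℝ) : ℂ) := by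
    intro s n
    simp only [LSeries.term_def, T]
    split_ifs with h
    · simp
    · rw [Complex.ofReal_mul, Complex.ofReal_cpow (by positivity), div_eq_mul_inv,
        Complex.ofReal_neg, Complex.cpow_neg]
      simp
  have hz : ∀ s : ℝ, NumberField.dedekindZeta K s = ((∑' n, T s n : ℝ) : ℂ) := by
    intro s
    rw [NumberField.dedekindZeta, LSeries, Complex.ofReal_tsum]
    exact tsum_congr fun n => hterm s n
  have hlim := NumberField.tendsto_sub_one_mul_dedekindZeta_nhdsGT K
  refine ⟨fun s => ∑' n, T s n, ?_, ?_⟩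
  · have h1 := (Complex.continuous_re.tendsto _).comp hlim
    simp only [Complex.ofReal_re] at h1
    refine h1.congr fun s => ?_
    simp only [Function.comp, hz]
    rw [← Complex.ofReal_one, ← Complex.ofReal_sub, ← Complex.ofReal_mul, Complex.ofReal_re]
  · have hne : ∀ᶠ s : ℝ in 𝓝[>] 1, ((s : ℂ) - 1) * NumberField.dedekindZeta K s ≠ 0 :=
      hlim.eventually_ne (by exact_mod_cast NumberField.dedekindZeta_residue_ne_zero K)
    filter_upwards [hne, self_mem_nhdsWithin] with s hs hs1
    have hs1 : (1 : ℝ) < s := hs1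
    refine ⟨?_, tsum_nonneg (hT0 s)⟩
    have hsum : Summable (T s) := by
      by_contra hcon
      rw [hz, tsum_eq_zero_of_not_summable hcon] at hs
      simp at hs
    rw [ENNReal.ofReal_tsum_of_nonneg (hT0 s) hsum]
    rw [← (Equiv.sigmaFiberEquiv (fun I : Ideal (𝓞 K) => Ideal.absNorm I)).tsum_eq,
      ENNReal.tsum_sigma']
    refine tsum_congr fun n => ?_
    have hfin : Finite {I : Ideal (𝓞 K) // Ideal.absNorm I = n} :=
      Ideal.finite_setOfPred_absNorm_eq n
    have hc : ∀ I : {I : Ideal (𝓞 K) // Ideal.absNorm I = n},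
        idealW K s ((Equiv.sigmaFiberEquiv (fun I : Ideal (𝓞 K) => Ideal.absNorm I)) ⟨n, I⟩) =
          ENNReal.ofReal ((n : ℝ) ^ (-s)) := by
      rintro ⟨I, hI⟩
      simp [idealW_apply, Equiv.sigmaFiberEquiv, hI]
    rw [tsum_congr hc, ENNReal.tsum_const]
    simp only [T]
    split_ifs with h0
    · subst h0
      simp [Real.zero_rpow (by linarith : -s ≠ 0)]
    · rw [ENNReal.ofReal_mul (by positivity), ENNReal.ofReal_natCast]
      congr 1
      rw [ENat.card_eq_coe_natCard]
      rfl
end Zeta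

section Compare
open scoped ENNReal Topology NumberField
open Filter

lemma zeta_contra (L K : Type*) [Field L] [NumberField L] [Field K] [NumberField K] (q : ℕ)
    (hq : 2 ≤ q) (C : ℕ)
    (h : ∀ s : ℝ, 1 < s → (∑' I, idealW L s I) ^ q ≤ (C : ℝ≥0∞) * ∑' I, idealW K s I) : False := by
  obtain ⟨ZL, hL, hLe⟩ := zeta_ev L
  obtain ⟨ZK, hK, hKe⟩ := zeta_ev K
  have hev : ∀ᶠ s in 𝓝[>] (1 : ℝ),
      ((s - 1) * ZL s) ^ q ≤ C * ((s - 1) ^ (q - 1) * ((s - 1) * ZK s)) := by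
    filter_upwards [hLe, hKe, self_mem_nhdsWithin] with s h1 h2 hs
    have hs : (1 : ℝ) < s := hs
    have h3 := h s hs
    rw [h1.1, h2.1, ← ENNReal.ofReal_natCast, ← ENNReal.ofReal_mul (by positivity),
      ← ENNReal.ofReal_pow h1.2, ENNReal.ofReal_le_ofReal_iff (mul_nonneg (by positivity) h2.2)] at h3
    have h4 : (s - 1) ^ q = (s - 1) ^ (q - 1) * (s - 1) := by
      rw [← pow_succ]; congr 1; omega
    rw [mul_pow]
    calc (s - 1) ^ q * ZL s ^ q ≤ (s - 1) ^ q * (C * ZK s) :=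
          mul_le_mul_of_nonneg_left h3 (pow_nonneg (by linarith) _)
      _ = _ := by rw [h4]; ring
  have hs0 : Tendsto (fun s : ℝ => (s - 1) ^ (q - 1)) (𝓝[>] 1) (𝓝 0) := by
    have : Tendsto (fun s : ℝ => (s - 1) ^ (q - 1)) (𝓝 1) (𝓝 ((1 - 1) ^ (q - 1))) :=
      Continuous.tendsto (by fun_prop) 1
    rw [sub_self, zero_pow (by omega)] at this
    exact this.mono_left nhdsWithin_le_nhds
  have hlim := le_of_tendsto_of_tendsto (hL.pow q) ((hs0.mul hK).const_mul (C : ℝ)) hev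
  have := pow_pos (NumberField.dedekindZeta_residue_pos L) q
  simp at hlim
  linarith
end Compare


section Split
open scoped NumberField

lemma zeta_sub_not_mem {R : Type*} [CommRing R] [IsDomain R] {q : ℕ} (hq : q.Prime) {ζ : R}
    (hζ : IsPrimitiveRoot ζ q) (P : Ideal R) [P.IsPrime] (hqP : (q : R) ∉ P) (i j : ℕ) (hij : i < j)
    (hj : j < q) : ζ ^ i - ζ ^ j ∉ P := by
  intro h
  have hu : IsUnit ζ := hζ.isUnit hq.ne_zero
  set f := Ideal.Quotient.mk P
  have h1 : f ζ ^ (j - i) = 1 := by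
    have h2 : f ζ ^ i = f ζ ^ j := by
      rw [← map_pow, ← map_pow]; exact Ideal.Quotient.eq.2 h
    have h3 : f ζ ^ i * f ζ ^ (j - i) = f ζ ^ i * 1 := by
      rw [← pow_add, mul_one, h2]; congr 1; omega
    exact (((hu.map f).pow i).mul_right_inj).1 h3
  have h2 : f ζ ^ q = 1 := by rw [← map_pow, hζ.pow_eq_one, map_one]
  have h3 : f ζ = 1 := by
    have : orderOf (f ζ) ∣ Nat.gcd (j - i) q :=
      Nat.dvd_gcd (orderOf_dvd_of_pow_eq_one h1) (orderOf_dvd_of_pow_eq_one h2)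
    have hc : Nat.gcd (j - i) q = 1 :=
      (Nat.coprime_of_lt_prime (n := j - i) (by omega) (by omega) hq).symm
    rw [hc, Nat.dvd_one, orderOf_eq_one_iff] at this
    exact this
  have h4 := congrArg f (hζ.geom_sum_eq_zero hq.one_lt)
  rw [map_sum] at h4
  simp only [map_pow, h3, one_pow, map_zero, sum_const, card_range, nsmul_eq_mul, mul_one] at h4
  apply hqP
  rw [← Ideal.Quotient.eq_zero_iff_mem, map_natCast]; exact h4

set_option linter.deprecated false in
lemma split_prime (L K : Type*) [Field L] [NumberField L] [Field K] [NumberField K] [Algebra L K]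
    (q : ℕ) (hq : q.Prime) (hfin : Module.finrank L K = q) (ζ : 𝓞 L) (hζ : IsPrimitiveRoot ζ q)
    (g : ℤ) (α : 𝓞 K) (hα : α ^ q = (g : 𝓞 K))
    (hσ : ∀ i : ℕ, ∃ τ : 𝓞 K ≃ₐ[𝓞 L] 𝓞 K, τ α = algebraMap (𝓞 L) (𝓞 K) ζ ^ i * α)
    (P : Ideal (𝓞 L)) [hP : P.IsPrime] (hP0 : P ≠ ⊥) (hqP : (q : 𝓞 L) ∉ P) (hgP : (g : 𝓞 L) ∉ P)
    (c : 𝓞 L) (hc : c ^ q - (g : 𝓞 L) ∈ P) :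
    #(IsDedekindDomain.primesOverFinset P (𝓞 K)) = q ∧
      ∀ Q ∈ IsDedekindDomain.primesOverFinset P (𝓞 K), Ideal.absNorm Q = Ideal.absNorm P := by
  have hmax : P.IsMaximal := hP.isMaximal hP0
  set ι := algebraMap (𝓞 L) (𝓞 K) with hι
  have hinj : Function.Injective ι := FaithfulSMul.algebraMap_injective _ _
  have hζ' : IsPrimitiveRoot (ι ζ) q := hζ.map_of_injective hinj
  have hsum := Ideal.sum_ramification_inertia (𝓞 K) L K (p := P) hP0
  rw [hfin] at hsum
  have hpos : ∀ Q ∈ IsDedekindDomain.primesOverFinset P (𝓞 K),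
      1 ≤ Ideal.ramificationIdx' P Q * Ideal.inertiaDeg' P Q := by
    intro Q hQ
    obtain ⟨h1, h2⟩ := (IsDedekindDomain.mem_primesOverFinset_iff hP0 _).mp hQ
    exact Right.one_le_mul
      (Nat.pos_iff_ne_zero.mpr <| Ideal.IsDedekindDomain.ramificationIdx'_ne_zero_of_liesOver _ hP0)
      (Nat.pos_iff_ne_zero.mpr <| Ideal.inertiaDeg'_ne_zero P Q)
  -- lower bound on the number of primes
  have hge : q ≤ #(IsDedekindDomain.primesOverFinset P (𝓞 K)) := by
    obtain ⟨Q0, hQ0, hQ0'⟩ : ∃ Q0 : Ideal (𝓞 K), Q0.IsPrime ∧ Q0.LiesOver P := by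
      obtain ⟨Q, hQ⟩ := (inferInstance : Nonempty (P.primesOver (𝓞 K)))
      exact ⟨Q, hQ.1, hQ.2⟩
    have hmem : ∀ x : 𝓞 L, ι x ∈ Q0 ↔ x ∈ P := by
      intro x; rw [hQ0'.over]; rfl
    obtain ⟨j, hj⟩ : ∃ j : ℕ, α - ι ζ ^ j * ι c ∈ Q0 := by
      have h1 : α ^ q - ι c ^ q ∈ Q0 := by
        have : α ^ q - ι c ^ q = - ι (c ^ q - g) := by
          rw [hα]; simp
        rw [this]
        exact Q0.neg_mem ((hmem _).2 hc)
      rw [hζ'.pow_sub_pow_eq_prod_sub_mul _ _ hq.pos] at h1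
      obtain ⟨μ, hμ, hμ2⟩ := (hQ0.prod_mem_iff).1 h1
      rw [Polynomial.mem_nthRootsFinset hq.pos] at hμ
      have : NeZero q := ⟨hq.ne_zero⟩
      obtain ⟨j, -, rfl⟩ := hζ'.eq_pow_of_pow_eq_one hμ
      exact ⟨j, hμ2⟩
    choose τ hτ using hσ
    let Qi : ℕ → Ideal (𝓞 K) := fun i => Q0.comap (τ i)
    have hQi : ∀ i, Qi i ∈ IsDedekindDomain.primesOverFinset P (𝓞 K) := by
      intro i
      rw [IsDedekindDomain.mem_primesOverFinset_iff hP0]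
      refine ⟨inferInstance, ⟨?_⟩⟩
      ext x
      simp only [Ideal.mem_comap, Qi, Ideal.under_def]
      rw [← hmem, ← hι, AlgEquiv.commutes]
    have hmemi : ∀ i (x : 𝓞 L), ι x ∈ Qi i ↔ x ∈ P := by
      intro i x
      simp only [Ideal.mem_comap, Qi]
      rw [AlgEquiv.commutes, hmem]
    have hai : ∀ i, α - ι ζ ^ (i + j) * ι c ∈ Qi i := by
      intro i
      simp only [Ideal.mem_comap, Qi]
      rw [map_sub, map_mul, map_pow, AlgEquiv.commutes, AlgEquiv.commutes, hτ]
      have : ι ζ ^ i * α - ι ζ ^ (i + j) * ι c = ι ζ ^ i * (α - ι ζ ^ j * ι c) := by ring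
      rw [this]
      exact Q0.mul_mem_left _ hj
    have hne : ∀ i i', i < i' → i' < q → Qi i ≠ Qi i' := by
      intro i i' hii hi' heq
      have h1 := hai i'
      rw [← heq] at h1
      have h2 := (Qi i).sub_mem h1 (hai i)
      have h3 : α - ι ζ ^ (i' + j) * ι c - (α - ι ζ ^ (i + j) * ι c) =
          ι (ζ ^ j * (ζ ^ i - ζ ^ i') * c) := by
        simp only [map_mul, map_sub, map_pow]; ring
      rw [h3, hmemi] at h2
      rcases hP.mem_or_mem h2 with h4 | h4
      · rcases hP.mem_or_mem h4 with h5 | h5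
        · exact hP.ne_top (P.eq_top_of_isUnit_mem h5 ((hζ.isUnit hq.ne_zero).pow j))
        · exact zeta_sub_not_mem hq hζ P hqP i i' hii hi' h5
      · apply hgP
        have := P.sub_mem (P.pow_mem_of_mem h4 q hq.pos) hc
        simpa using this
    have hinjon : Set.InjOn Qi (Finset.range q : Set ℕ) := by
      intro i hi i' hi' h
      simp only [coe_range, Set.mem_Iio] at hi hi'
      rcases lt_trichotomy i i' with h1 | h1 | h1
      · exact absurd h (hne i i' h1 hi')
      · exact h1
      · exact absurd h.symm (hne i' i h1 hi)
    calc q = #(Finset.range q) := (card_range q).symm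
      _ = #((Finset.range q).image Qi) := (card_image_of_injOn hinjon).symm
      _ ≤ _ := card_le_card (by
          intro x hx
          obtain ⟨i, -, rfl⟩ := mem_image.1 hx
          exact hQi i)
  have hle : #(IsDedekindDomain.primesOverFinset P (𝓞 K)) ≤ q := by
    rw [← hsum, Finset.card_eq_sum_ones]
    exact sum_le_sum hpos
  have hcard := le_antisymm hle hge
  refine ⟨hcard, fun Q hQ => ?_⟩
  have hone : Ideal.ramificationIdx' P Q * Ideal.inertiaDeg' P Q = 1 := by
    have h1 : ∑ Q ∈ IsDedekindDomain.primesOverFinset P (𝓞 K), 1 =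
        ∑ Q ∈ IsDedekindDomain.primesOverFinset P (𝓞 K),
          Ideal.ramificationIdx' P Q * Ideal.inertiaDeg' P Q := by
      rw [hsum, ← Finset.card_eq_sum_ones, hcard]
    exact ((sum_eq_sum_iff_of_le hpos).1 h1 Q hQ).symm
  obtain ⟨h1, h2⟩ := (IsDedekindDomain.mem_primesOverFinset_iff hP0 _).mp hQ
  rw [Ideal.absNorm_eq_pow_inertiaDeg'_of_liesOver Q P hP hP0, Nat.eq_one_of_mul_eq_one_left hone,
    pow_one]
end Split


section Kummer
open scoped NumberField
open Polynomial

lemma kummer_ext (L : Type) [Field L] [NumberField L] (q : ℕ) (hq : q.Prime) (ζ : L)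
    (hζ : IsPrimitiveRoot ζ q) (h : L) (hh : ∀ b : L, b ^ q ≠ h) :
    ∃ (K : Type) (_ : Field K) (_ : NumberField K) (_ : Algebra L K) (β : K) (σ : K ≃ₐ[L] K),
      Module.finrank L K = q ∧ β ^ q = algebraMap L K h ∧ σ β = algebraMap L K ζ * β ∧
      ∀ x, σ x = x → ∃ y, algebraMap L K y = x := by
  have hirr : Irreducible (X ^ q - C h : L[X]) := X_pow_sub_C_irreducible_of_prime hq hh
  have hne : (X ^ q - C h : L[X]) ≠ 0 := hirr.ne_zero
  have : Fact (Irreducible (X ^ q - C h : L[X])) := ⟨hirr⟩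
  have hfd : FiniteDimensional L (AdjoinRoot (X ^ q - C h : L[X])) :=
    (AdjoinRoot.powerBasis hne).finite
  have hfr : Module.finrank L (AdjoinRoot (X ^ q - C h : L[X])) = q := by
    rw [(AdjoinRoot.powerBasis hne).finrank, AdjoinRoot.powerBasis_dim, natDegree_X_pow_sub_C]
  have hnf : NumberField (AdjoinRoot (X ^ q - C h : L[X])) := NumberField.of_module_finite L _
  have : NeZero q := ⟨hq.ne_zero⟩
  let η : rootsOfUnity q L := hζ.toRootsOfUnity
  let σ := autAdjoinRootXPowSubC q h η
  have hσ : σ (AdjoinRoot.root (X ^ q - C h)) =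
      algebraMap L (AdjoinRoot (X ^ q - C h : L[X])) ζ * AdjoinRoot.root _ := by
    rw [← Algebra.smul_def]
    exact autAdjoinRootXPowSubC_root h η
  have hβq : (AdjoinRoot.root (X ^ q - C h)) ^ q = algebraMap L (AdjoinRoot (X ^ q - C h : L[X])) h :=
    root_X_pow_sub_C_pow q h
  have hβ0 : AdjoinRoot.root (X ^ q - C h : L[X]) ≠ 0 := by
    intro h0
    rw [h0, zero_pow hq.ne_zero] at hβq
    have : h = 0 := by
      apply (algebraMap L (AdjoinRoot (X ^ q - C h : L[X]))).injective
      rw [← hβq, map_zero]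
    exact hh 0 (by rw [zero_pow hq.ne_zero, this])
  refine ⟨AdjoinRoot (X ^ q - C h : L[X]), inferInstance, hnf, inferInstance,
    AdjoinRoot.root _, σ, hfr, hβq, hσ, ?_⟩
  have hσ1 : σ ≠ 1 := by
    intro h1
    rw [h1, AlgEquiv.one_apply] at hσ
    have := mul_right_cancel₀ hβ0 ((one_mul _).trans hσ)
    rw [eq_comm, map_eq_one_iff _ (algebraMap L _).injective] at this
    exact hζ.ne_one hq.one_lt this
  have hord : orderOf σ = q := by
    have : Fact q.Prime := ⟨hq⟩
    refine orderOf_eq_prime ?_ hσ1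
    show (autAdjoinRootXPowSubC q h η) ^ q = 1
    rw [← map_pow]
    have : η ^ q = 1 := by
      ext; simp [η, hζ.pow_eq_one]
    rw [this, map_one]
  intro x hx
  let H := Subgroup.zpowers σ
  have h1 : Module.finrank (IntermediateField.fixedField H) (AdjoinRoot (X ^ q - C h : L[X])) = q := by
    rw [IntermediateField.finrank_fixedField_eq_card, Nat.card_zpowers, hord]
  have h2 := Module.finrank_mul_finrank L (IntermediateField.fixedField H)
    (AdjoinRoot (X ^ q - C h : L[X]))
  rw [h1, hfr] at h2
  have h3 : Module.finrank L (IntermediateField.fixedField H) = 1 :=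
    Nat.eq_of_mul_eq_mul_right hq.pos (by rw [h2, one_mul])
  have h4 := IntermediateField.finrank_eq_one_iff.1 h3
  have h5 : x ∈ IntermediateField.fixedField H := by
    rw [IntermediateField.mem_fixedField_iff]
    intro f hf
    have : σ ∈ MulAction.stabilizer (AdjoinRoot (X ^ q - C h : L[X]) ≃ₐ[L] _) x := hx
    exact (Subgroup.zpowers_le.2 this) hf
  rw [h4] at h5
  exact IntermediateField.mem_bot.1 h5
end Kummer

section Nonres
open scoped NumberField ENNReal

lemma nonresidue (L : Type) [Field L] [NumberField L] (q : ℕ) (hq : q.Prime) (ζ : L)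
    (hζ : IsPrimitiveRoot ζ q) (g : ℤ) (hg0 : g ≠ 0) (hg : ∀ b : L, b ^ q ≠ (g : L))
    (Δ : ℤ) (hΔ : Δ ≠ 0) :
    ∃ P : Ideal (𝓞 L), P.IsPrime ∧ P ≠ ⊥ ∧ (Δ : 𝓞 L) ∉ P ∧ ¬ ∃ x : 𝓞 L, x ^ q - (g : 𝓞 L) ∈ P := by
  classical
  by_contra hcon
  push Not at hcon
  obtain ⟨K, _, _, _, β, σ, hfr, hβ, hσ, -⟩ := kummer_ext L q hq ζ hζ (g : L) hg
  have : NeZero q := ⟨hq.ne_zero⟩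
  set ζ' : 𝓞 L := hζ.toInteger with hζ'def
  have hζ' : IsPrimitiveRoot ζ' q := hζ.toInteger_isPrimitiveRoot
  have hβi : IsIntegral ℤ β := by
    refine IsIntegral.of_pow hq.pos ?_
    rw [hβ, map_intCast]
    exact isIntegral_algebraMap (R := ℤ) (x := g)
  let α : 𝓞 K := ⟨β, hβi⟩
  have hα : α ^ q = (g : 𝓞 K) := by
    apply NumberField.RingOfIntegers.ext
    have h1 : algebraMap (𝓞 K) K (α ^ q) = algebraMap (𝓞 K) K (g : 𝓞 K) := by
      rw [map_pow, map_intCast, ← map_intCast (algebraMap L K), ← hβ]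
      rfl
    exact h1
  have hτ : ∀ i : ℕ, ∃ τ : 𝓞 K ≃ₐ[𝓞 L] 𝓞 K, τ α = algebraMap (𝓞 L) (𝓞 K) ζ' ^ i * α := by
    intro i
    refine ⟨NumberField.RingOfIntegers.mapAlgEquiv (σ ^ i), ?_⟩
    apply NumberField.RingOfIntegers.ext
    have h1 : ∀ i : ℕ, (σ ^ i) β = algebraMap L K ζ ^ i * β := by
      intro i
      induction i with
      | zero => simp
      | succ n ih => rw [pow_succ', AlgEquiv.mul_apply, ih, map_mul, map_pow, AlgEquiv.commutes, hσ]; ring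
    exact h1 i
  let bad : Finset (Ideal (𝓞 L)) :=
    (Ideal.finite_factors (R := 𝓞 L) (I := Ideal.span {((Δ * q * g : ℤ) : 𝓞 L)}) (by
      simp [hΔ, hq.ne_zero, hg0])).toFinset.image (fun v => v.asIdeal)
  have hbad : ∀ P : Ideal (𝓞 L), Prime P → P ∉ bad → ((Δ * q * g : ℤ) : 𝓞 L) ∉ P := by
    intro P hP hPb hmem
    apply hPb
    simp only [bad, mem_image, Set.Finite.mem_toFinset]
    refine ⟨⟨P, Ideal.isPrime_of_prime hP, hP.ne_zero⟩, ?_, rfl⟩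
    show P ∣ _
    rw [Ideal.dvd_span_singleton]; exact hmem
  have key : ∀ P : Ideal (𝓞 L), Prime P → P ∉ bad →
      #(IsDedekindDomain.primesOverFinset P (𝓞 K)) = q ∧
      ∀ Q ∈ IsDedekindDomain.primesOverFinset P (𝓞 K), Ideal.absNorm Q = Ideal.absNorm P := by
    intro P hP hPb
    have h1 := hbad P hP hPb
    have hPp := Ideal.isPrime_of_prime hP
    have hD : (Δ : 𝓞 L) ∉ P := fun h => h1 (by
      push_cast; exact P.mul_mem_right _ (P.mul_mem_right _ h))
    obtain ⟨c, hc⟩ := hcon P hPp hP.ne_zero hD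
    exact split_prime L K q hq hfr ζ' hζ' g α hα hτ P hP.ne_zero
      (fun h => h1 (by push_cast; exact P.mul_mem_right _ (P.mul_mem_left _ h)))
      (fun h => h1 (by push_cast; exact P.mul_mem_left _ h)) c hc
  have hmem : ∀ P : Ideal (𝓞 L), Prime P → ∀ Q ∈ IsDedekindDomain.primesOverFinset P (𝓞 K),
      Q.IsPrime ∧ Q.LiesOver P := by
    intro P hP Q hQ
    have hPp := Ideal.isPrime_of_prime hP
    have hm : P.IsMaximal := hPp.isMaximal hP.ne_zero
    exact (IsDedekindDomain.mem_primesOverFinset_iff hP.ne_zero _).mp hQ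
  apply zeta_contra L K q hq.two_le (2 ^ (q * #bad))
  intro s hs
  rw [Nat.cast_pow, Nat.cast_ofNat]
  refine euler_compare q (idealW L s) ?_ (idealW K s) (idealW_half L hs) bad
    (fun P => IsDedekindDomain.primesOverFinset P (𝓞 K)) ?_ ?_ ?_ ?_
  · rw [idealW_apply]
    simp [Real.zero_rpow (by linarith : -s ≠ 0)]
  · intro P hP hb Q hQ
    obtain ⟨h1, h2⟩ := hmem P hP Q hQ
    exact Ideal.prime_of_isPrime (Ideal.ne_bot_of_liesOver_of_ne_bot hP.ne_zero Q) h1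
  · intro P hP hb; exact (key P hP hb).1
  · intro P hP hb Q hQ
    rw [idealW_apply, idealW_apply, (key P hP hb).2 Q hQ]
  · intro P P' hP hb hP' hb' Q hQ hQ'
    rw [(hmem P hP Q hQ).2.over, (hmem P' hP' Q hQ').2.over]
end Nonres


section Tower
open scoped NumberField

lemma kummer_tower (q : ℕ) (hq : q.Prime) (g : ℤ) (hg0 : g ≠ 0) (hs : List ℤ) :
    ∀ (F : Type) [Field F] [NumberField F] (ζ : F) (_ : IsPrimitiveRoot ζ q) (_ : ∀ h ∈ hs, h ≠ 0)
      (_ : ∀ m ∈ Submonoid.closure {h | h ∈ hs}, ∀ b : F, b ^ q ≠ ((g * m : ℤ) : F)),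
      ∃ (L : Type) (_ : Field L) (_ : NumberField L) (_ : F →+* L),
        (∀ h ∈ hs, ∃ b : L, b ^ q = (h : L)) ∧ ∀ b : L, b ^ q ≠ (g : L) := by
  induction hs with
  | nil =>
    intro F _ _ ζ hζ _ hcl
    refine ⟨F, inferInstance, inferInstance, RingHom.id F, by simp, ?_⟩
    simpa using hcl 1 (Submonoid.one_mem _)
  | cons h hs ih =>
    intro F _ _ ζ hζ h0 hcl
    have hsub : ∀ m ∈ Submonoid.closure {x | x ∈ hs}, m ∈ Submonoid.closure {x | x ∈ h :: hs} := by
      intro m hm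
      exact Submonoid.closure_mono (fun x hx => List.mem_cons_of_mem _ hx) hm
    have hh : h ∈ Submonoid.closure {x | x ∈ h :: hs} := Submonoid.subset_closure (by simp)
    have hne : ∀ m ∈ Submonoid.closure {x | x ∈ hs}, m ≠ 0 := by
      intro m hm
      induction hm using Submonoid.closure_induction with
      | mem x hx => exact h0 x (List.mem_cons_of_mem _ hx)
      | one => exact one_ne_zero
      | mul x y _ _ h1 h2 => exact mul_ne_zero h1 h2
    by_cases hpow : ∃ b : F, b ^ q = (h : F)
    · obtain ⟨b, hb⟩ := hpow
      obtain ⟨L, i1, i2, f, h1, h2⟩ := ih F ζ hζ (fun x hx => h0 x (List.mem_cons_of_mem _ hx))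
        (fun m hm => hcl m (hsub m hm))
      refine ⟨L, i1, i2, f, ?_, h2⟩
      intro x hx
      rcases List.mem_cons.1 hx with rfl | hx
      · exact ⟨f b, by rw [← map_pow, hb, map_intCast]⟩
      · exact h1 x hx
    · push Not at hpow
      obtain ⟨K, _, _, _, β, σ, hfr, hβ, hσ, hfix⟩ := kummer_ext F q hq ζ hζ (h : F) hpow
      set ι := algebraMap F K with hι
      have hζ' : IsPrimitiveRoot (ι ζ) q := hζ.map_of_injective ι.injective
      have hstep : ∀ m ∈ Submonoid.closure {x | x ∈ hs}, ∀ b : K, b ^ q ≠ ((g * m : ℤ) : K) := by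
        intro m hm γ hγ
        have hγ0 : γ ≠ 0 := by
          intro h1
          rw [h1, zero_pow hq.ne_zero] at hγ
          exact mul_ne_zero hg0 (hne m hm) (by exact_mod_cast hγ.symm)
        have : NeZero q := ⟨hq.ne_zero⟩
        have h1 : (σ γ / γ) ^ q = 1 := by
          rw [div_pow, ← map_pow, hγ, map_intCast, div_self]
          rw [← hγ]; exact pow_ne_zero _ hγ0
        obtain ⟨j, hj, hj2⟩ := hζ'.eq_pow_of_pow_eq_one h1
        have h2 : σ γ = ι ζ ^ j * γ := by rw [hj2, div_mul_cancel₀ _ hγ0]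
        obtain ⟨y, hy⟩ := hfix (γ * β ^ (q - j)) (by
          rw [map_mul, map_pow, h2, hσ, mul_pow]
          have : ι ζ ^ j * ι ζ ^ (q - j) = 1 := by
            rw [← pow_add, Nat.add_sub_cancel' hj.le, hζ'.pow_eq_one]
          calc _ = (ι ζ ^ j * ι ζ ^ (q - j)) * (γ * β ^ (q - j)) := by ring
            _ = _ := by rw [this, one_mul])
        refine hcl (m * h ^ (q - j)) (mul_mem (hsub m hm) (pow_mem hh _)) y ?_
        apply ι.injective
        rw [map_pow, hy, mul_pow, hγ, ← pow_mul, mul_comm (q - j), pow_mul, hβ]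
        simp [mul_assoc]
      obtain ⟨L, i1, i2, f, h1, h2⟩ := ih K (ι ζ) hζ' (fun x hx => h0 x (List.mem_cons_of_mem _ hx))
        hstep
      refine ⟨L, i1, i2, f.comp ι, ?_, h2⟩
      intro x hx
      rcases List.mem_cons.1 hx with rfl | hx
      · exact ⟨f β, by rw [← map_pow, hβ, map_intCast, map_intCast]⟩
      · exact h1 x hx

lemma cyclo_pow (q : ℕ) (hq : q.Prime) (φ : ℤ → ZMod q)
    (hφ : ∀ a b, a ≠ 0 → b ≠ 0 → φ (a * b) = φ a + φ b) (m : ℤ) (hm : m ≠ 0)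
    (x : CyclotomicField q ℚ) (hx : x ^ q = (m : CyclotomicField q ℚ)) : φ m = 0 := by
  have : NeZero q := ⟨hq.ne_zero⟩
  have : IsCyclotomicExtension {q} ℚ (CyclotomicField q ℚ) :=
    CyclotomicField.isCyclotomicExtension q ℚ
  have hφ1 : φ 1 = 0 := by
    have := hφ 1 1 one_ne_zero one_ne_zero
    simpa using this
  have hφp : ∀ (a : ℤ) (n : ℕ), a ≠ 0 → φ (a ^ n) = n * φ a := by
    intro a n ha
    induction n with
    | zero => simpa using hφ1
    | succ n ih => rw [pow_succ, hφ _ _ (pow_ne_zero _ ha) ha, ih]; push_cast; ring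
  have hfr : Module.finrank ℚ (CyclotomicField q ℚ) = q - 1 := by
    rw [IsCyclotomicExtension.finrank (n := q) _ (Polynomial.cyclotomic.irreducible_rat hq.pos),
      Nat.totient_prime hq]
  have h1 := congrArg (Algebra.norm ℚ) hx
  rw [map_pow, ← map_intCast (algebraMap ℚ (CyclotomicField q ℚ)), Algebra.norm_algebraMap, hfr] at h1
  set y := Algebra.norm ℚ x
  obtain ⟨n, hn⟩ : ∃ n : ℤ, (n : ℚ) = y := by
    have : IsIntegral ℤ y := by
      refine IsIntegral.of_pow hq.pos ?_
      rw [h1, ← Int.cast_pow]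
      exact isIntegral_algebraMap (R := ℤ) (x := m ^ (q - 1))
    exact IsIntegrallyClosed.isIntegral_iff.1 this
  rw [← hn] at h1
  have h2 : n ^ q = m ^ (q - 1) := by exact_mod_cast h1
  have hn0 : n ≠ 0 := by
    rintro rfl
    rw [zero_pow hq.ne_zero] at h2
    exact pow_ne_zero _ hm h2.symm
  have h3 := congrArg φ h2
  rw [hφp _ _ hn0, hφp _ _ hm, CharP.cast_eq_zero, zero_mul, Nat.cast_sub hq.one_le,
    CharP.cast_eq_zero] at h3
  simpa using h3.symm

lemma detect (q : ℕ) (hq : q.Prime) (φ : ℤ → ZMod q)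
    (hφ : ∀ a b, a ≠ 0 → b ≠ 0 → φ (a * b) = φ a + φ b) (S : Finset ℤ) (hS0 : ∀ s ∈ S, s ≠ 0)
    (Δ : ℕ) (hΔ : 0 < Δ) :
    ∃ r : ℕ, (r = 1 ∨ r.Prime) ∧ Nat.Coprime r Δ ∧
      ∀ s ∈ S, (∃ x : ℤ, (r : ℤ) ∣ x ^ q - s) → φ s = 0 := by
  classical
  by_cases hall : ∀ s ∈ S, φ s = 0
  · exact ⟨1, Or.inl rfl, Nat.coprime_one_left _, fun s hs _ => hall s hs⟩
  push Not at hall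
  obtain ⟨g, hgS, hg⟩ := hall
  have : NeZero q := ⟨hq.ne_zero⟩
  have : Fact q.Prime := ⟨hq⟩
  have : IsCyclotomicExtension {q} ℚ (CyclotomicField q ℚ) :=
    CyclotomicField.isCyclotomicExtension q ℚ
  have hg0 := hS0 g hgS
  have hφ1 : φ 1 = 0 := by
    have := hφ 1 1 one_ne_zero one_ne_zero
    simpa using this
  have hφp : ∀ (a : ℤ) (n : ℕ), a ≠ 0 → φ (a ^ n) = n * φ a := by
    intro a n ha
    induction n with
    | zero => simpa using hφ1
    | succ n ih => rw [pow_succ, hφ _ _ (pow_ne_zero _ ha) ha, ih]; push_cast; ring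
  let b : ℤ → ℕ := fun s => (-φ s / φ g).val
  have hb : ∀ s, ((b s : ℕ) : ZMod q) * φ g = - φ s := by
    intro s
    simp only [b, ZMod.natCast_val, ZMod.cast_id', id_eq]
    field_simp
  let hs : List ℤ := S.toList.map (fun s => s * g ^ b s)
  have hsne : ∀ h ∈ hs, h ≠ 0 := by
    intro h hh
    obtain ⟨s, hs, rfl⟩ := List.mem_map.1 hh
    exact mul_ne_zero (hS0 s (by simpa using hs)) (pow_ne_zero _ hg0)
  have hcl : ∀ m ∈ Submonoid.closure {h | h ∈ hs}, m ≠ 0 ∧ φ m = 0 := by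
    intro m hm
    induction hm using Submonoid.closure_induction with
    | mem x hx =>
      refine ⟨hsne x hx, ?_⟩
      obtain ⟨s, hs, rfl⟩ := List.mem_map.1 hx
      rw [hφ _ _ (hS0 s (by simpa using hs)) (pow_ne_zero _ hg0), hφp _ _ hg0, hb]; ring
    | one => exact ⟨one_ne_zero, hφ1⟩
    | mul x y _ _ h1 h2 => exact ⟨mul_ne_zero h1.1 h2.1, by rw [hφ _ _ h1.1 h2.1, h1.2, h2.2, add_zero]⟩
  obtain ⟨L, _, _, f, hL1, hL2⟩ := kummer_tower q hq g hg0 hs (CyclotomicField q ℚ)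
    (IsCyclotomicExtension.zeta q ℚ _) (IsCyclotomicExtension.zeta_spec q ℚ _) hsne (by
      intro m hm x hx
      have := cyclo_pow q hq φ hφ (g * m) (mul_ne_zero hg0 (hcl m hm).1) x hx
      rw [hφ _ _ hg0 (hcl m hm).1, (hcl m hm).2, add_zero] at this
      exact hg this)
  have hζL : IsPrimitiveRoot (f (IsCyclotomicExtension.zeta q ℚ _)) q :=
    (IsCyclotomicExtension.zeta_spec q ℚ (CyclotomicField q ℚ)).map_of_injective f.injective
  obtain ⟨P, hP, hP0, hPΔ, hPx⟩ := nonresidue L q hq _ hζL g hg0 hL2 (Δ * ∏ s ∈ S, s)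
    (mul_ne_zero (by exact_mod_cast hΔ.ne') (prod_ne_zero_iff.2 hS0))
  have hmax : P.IsMaximal := hP.isMaximal hP0
  let _ : Field (𝓞 L ⧸ P) := Ideal.Quotient.field P
  set π : 𝓞 L →+* 𝓞 L ⧸ P := Ideal.Quotient.mk P
  have hπ0 : ∀ s ∈ S, ((s : ℤ) : 𝓞 L ⧸ P) ≠ 0 := by
    intro s hs h0
    apply hPΔ
    rw [← map_intCast π, Ideal.Quotient.eq_zero_iff_mem] at h0
    obtain ⟨t, ht⟩ := dvd_prod_of_mem (fun s : ℤ => s) hs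
    rw [ht]; push_cast
    exact P.mul_mem_left _ (P.mul_mem_right _ h0)
  obtain ⟨r, hr⟩ := CharP.exists (𝓞 L ⧸ P)
  have hrp : r.Prime := by
    rcases CharP.char_is_prime_or_zero (𝓞 L ⧸ P) r with h | h
    · exact h
    · exfalso
      subst h
      have h1 : ((Ideal.absNorm P : ℕ) : 𝓞 L ⧸ P) = 0 := by
        rw [← map_natCast π, Ideal.Quotient.eq_zero_iff_mem]
        exact Ideal.absNorm_mem P
      rw [CharP.cast_eq_zero_iff _ 0, zero_dvd_iff] at h1
      exact hP0 (Ideal.absNorm_eq_zero_iff.1 h1)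
  refine ⟨r, Or.inr hrp, ?_, ?_⟩
  · rw [hrp.coprime_iff_not_dvd]
    intro hd
    rw [← CharP.cast_eq_zero_iff (𝓞 L ⧸ P) r, ← map_natCast π, Ideal.Quotient.eq_zero_iff_mem] at hd
    apply hPΔ
    push_cast
    exact P.mul_mem_right _ hd
  · rintro s hs' ⟨x, hx⟩
    by_contra hφs
    have hxs : ((x : ℤ) : 𝓞 L ⧸ P) ^ q = (s : 𝓞 L ⧸ P) := by
      have h1 : ((x ^ q - s : ℤ) : 𝓞 L ⧸ P) = 0 := (CharP.intCast_eq_zero_iff _ r _).2 hx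
      push_cast at h1
      exact sub_eq_zero.1 h1
    have hx0 : ((x : ℤ) : 𝓞 L ⧸ P) ≠ 0 := by
      intro h0
      rw [h0, zero_pow hq.ne_zero] at hxs
      exact hπ0 s hs' hxs.symm
    obtain ⟨y, hy⟩ := hL1 (s * g ^ b s) (List.mem_map.2 ⟨s, by simpa using hs', rfl⟩)
    have hyi : IsIntegral ℤ y := by
      refine IsIntegral.of_pow hq.pos ?_
      rw [hy]
      exact isIntegral_algebraMap (R := ℤ) (x := s * g ^ b s)
    let y' : 𝓞 L := ⟨y, hyi⟩
    have hy' : y' ^ q = ((s * g ^ b s : ℤ) : 𝓞 L) := by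
      apply NumberField.RingOfIntegers.ext
      have h1 : algebraMap (𝓞 L) L (y' ^ q) = algebraMap (𝓞 L) L ((s * g ^ b s : ℤ) : 𝓞 L) := by
        rw [map_pow, map_intCast, ← hy]
        rfl
      exact h1
    have hyq := congrArg π hy'
    rw [map_pow, map_intCast] at hyq
    push_cast at hyq
    rw [← hxs] at hyq
    -- `g ^ b` is a `q`-th power modulo `P`
    have hgb : (g : 𝓞 L ⧸ P) ^ b s = (π y' / x) ^ q := by
      rw [div_pow, hyq]
      field_simp
    have hbs : ((b s : ℕ) : ZMod q) ≠ 0 := by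
      intro h0
      have := hb s
      rw [h0, zero_mul] at this
      exact hφs (neg_eq_zero.1 this.symm)
    obtain ⟨u, t, hut⟩ : ∃ u t : ℕ, b s * u = 1 + q * t := by
      let u := ((b s : ZMod q)⁻¹).val
      have h1 : ((b s * u : ℕ) : ZMod q) = 1 := by
        have h0 : ((u : ℕ) : ZMod q) = (b s : ZMod q)⁻¹ := ZMod.natCast_zmod_val _
        rw [Nat.cast_mul, h0, mul_inv_cancel₀ hbs]
      have h2 : 1 ≤ b s * u := by
        rcases Nat.eq_zero_or_pos (b s * u) with h | h
        · rw [h] at h1; simp at h1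
        · exact h
      have h3 : ((b s * u - 1 : ℕ) : ZMod q) = 0 := by
        rw [Nat.cast_sub h2, h1]; simp
      rw [ZMod.natCast_eq_zero_iff] at h3
      obtain ⟨t, ht⟩ := h3
      exact ⟨u, t, by omega⟩
    have hgk : (g : 𝓞 L ⧸ P) ≠ 0 := hπ0 g hgS
    have hgz : ((π y' / (x : 𝓞 L ⧸ P)) ^ u / (g : 𝓞 L ⧸ P) ^ t) ^ q = (g : 𝓞 L ⧸ P) := by
      rw [div_pow, ← pow_mul, mul_comm u q, pow_mul, ← hgb, ← pow_mul, hut, ← pow_mul, mul_comm t q,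
        pow_add, pow_one, mul_div_assoc, div_self (pow_ne_zero _ hgk), mul_one]
    obtain ⟨z, hz⟩ := Ideal.Quotient.mk_surjective ((π y' / (x : 𝓞 L ⧸ P)) ^ u / (g : 𝓞 L ⧸ P) ^ t)
    apply hPx
    refine ⟨z, ?_⟩
    rw [← Ideal.Quotient.eq_zero_iff_mem, map_sub, map_pow, hz, hgz, map_intCast, sub_self]
end Tower


section Geometry

lemma vecOf_mul (q : ℕ) (P : Finset ℕ) (a b : ℤ) (ha : a ≠ 0) (hb : b ≠ 0) :
    vecOf q P (a * b) = vecOf q P a + vecOf q P b := by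
  funext i
  simp [vecOf, Int.natAbs_mul, Nat.factorization_mul (Int.natAbs_ne_zero.2 ha) (Int.natAbs_ne_zero.2 hb)]

lemma vecOf_pow (q : ℕ) (P : Finset ℕ) (a : ℤ) (n : ℕ) :
    vecOf q P (a ^ n) = (n : ZMod q) • vecOf q P a := by
  funext i
  simp [vecOf, Int.natAbs_pow, Nat.factorization_pow]

lemma vecOf_prod (q : ℕ) (P : Finset ℕ) {ι : Type*} (s : Finset ι) (f : ι → ℤ)
    (hf : ∀ i ∈ s, f i ≠ 0) : vecOf q P (∏ i ∈ s, f i) = ∑ i ∈ s, vecOf q P (f i) := by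
  classical
  induction s using Finset.induction_on with
  | empty => funext i; simp [vecOf]
  | insert a s ha ih =>
    rw [prod_insert ha, sum_insert ha, vecOf_mul, ih]
    · intro i hi; exact hf i (mem_insert_of_mem hi)
    · exact hf a (mem_insert_self _ _)
    · exact prod_ne_zero_iff.2 fun i hi => hf i (mem_insert_of_mem hi)

lemma mem_qPrimes (q : ℕ) (S : Finset ℤ) (p : ℕ) :
    p ∈ qPrimes q S ↔ ∃ s ∈ S, p ∈ s.natAbs.primeFactors ∧ ¬ q ∣ s.natAbs.factorization p := by
  simp only [qPrimes, Finset.mem_sup, mem_filter]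

lemma vecOf_ne_zero (q : ℕ) (hodd : Odd q) (P : Finset ℕ) (s : ℤ) (hs0 : s ≠ 0)
    (hs : ¬ IsPerfectPow q s)
    (hP : ∀ p ∈ s.natAbs.primeFactors, ¬ q ∣ s.natAbs.factorization p → p ∈ P) :
    vecOf q P s ≠ 0 := by
  intro h0
  apply hs
  have hd : ∀ p ∈ s.natAbs.primeFactors, q ∣ s.natAbs.factorization p := by
    intro p hp
    by_contra hn
    have h1 := congrFun h0 ((P.orderIsoOfFin rfl).symm ⟨p, hP p hp hn⟩)
    simp only [vecOf, OrderIso.apply_symm_apply, Pi.zero_apply] at h1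
    rw [ZMod.natCast_eq_zero_iff] at h1
    exact hn h1
  let m := ∏ p ∈ s.natAbs.primeFactors, p ^ (s.natAbs.factorization p / q)
  have hm : m ^ q = s.natAbs := by
    conv_rhs => rw [← Nat.prod_factorization_pow_eq_self (Int.natAbs_ne_zero.2 hs0)]
    rw [Finsupp.prod, Nat.support_factorization, ← prod_pow]
    refine prod_congr rfl fun p hp => ?_
    rw [← pow_mul, Nat.div_mul_cancel (hd p hp)]
  rcases Int.natAbs_eq s with h | h
  · exact ⟨m, by rw [h, ← hm]; push_cast; rfl⟩
  · exact ⟨-m, by rw [hodd.neg_pow, h, ← hm]; push_cast; rfl⟩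

lemma exists_list_blocking (q k : ℕ) (hq : q.Prime) (S : Finset ℤ) (hS0 : ∀ s ∈ S, s ≠ 0)
    (hS : MemT q k ↑S) (P : Finset ℕ) (fs : List (Module.Dual (ZMod q) (Fin P.card → ZMod q)))
    (hfs : fs.length ≤ k) : ∃ s ∈ S, ∀ f ∈ fs, f (vecOf q P s) = 0 := by
  obtain ⟨Δ, hΔ, h⟩ := hS
  have key : ∀ fs : List (Module.Dual (ZMod q) (Fin P.card → ZMod q)),
      ∃ N : ℕ, 0 < N ∧ N.primeFactorsList.length ≤ fs.length ∧ Nat.Coprime N Δ ∧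
        ∀ s ∈ S, (∃ x : ℤ, (N : ℤ) ∣ x ^ q - s) → ∀ f ∈ fs, f (vecOf q P s) = 0 := by
    intro fs
    induction fs with
    | nil => exact ⟨1, one_pos, by simp, by simp, by simp⟩
    | cons f fs ih =>
      obtain ⟨N, h1, h2, h3, h4⟩ := ih
      obtain ⟨r, hr, hrc, hr2⟩ := detect q hq (fun a => f (vecOf q P a))
        (fun a b ha hb => by rw [vecOf_mul q P a b ha hb, map_add]) S hS0 Δ hΔ
      have hr0 : 0 < r := by
        rcases hr with rfl | hr
        · exact one_pos
        · exact hr.pos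
      have hrl : r.primeFactorsList.length ≤ 1 := by
        rcases hr with rfl | hr
        · simp
        · simp [Nat.primeFactorsList_prime hr]
      refine ⟨r * N, Nat.mul_pos hr0 h1, ?_, Nat.Coprime.mul_left hrc h3, ?_⟩
      · rw [(Nat.perm_primeFactorsList_mul hr0.ne' h1.ne').length_eq, List.length_append,
          List.length_cons]
        omega
      · rintro s hs ⟨x, hx⟩ f' hf'
        push_cast at hx
        rcases List.mem_cons.1 hf' with rfl | hf'
        · exact hr2 s hs ⟨x, (Dvd.intro _ rfl).trans hx⟩
        · exact h4 s hs ⟨x, (Dvd.intro_left _ rfl).trans hx⟩ f' hf'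
  obtain ⟨N, h1, h2, h3, h4⟩ := key fs
  obtain ⟨s, hs, hx⟩ := h N h1 (h2.trans hfs) h3
  exact ⟨s, hs, h4 s hs hx⟩

lemma exists_equiv_map {F V : Type*} [Field F] [AddCommGroup V] [Module F V] [FiniteDimensional F V]
    (U U' : Submodule F V) (h : Module.finrank F U = Module.finrank F U') :
    ∃ Ψ : V ≃ₗ[F] V, ∀ v, Ψ v ∈ U' ↔ v ∈ U := by
  obtain ⟨C, hC⟩ := Submodule.exists_isCompl U
  obtain ⟨C', hC'⟩ := Submodule.exists_isCompl U'
  have h1 := Submodule.finrank_add_eq_of_isCompl hC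
  have h2 := Submodule.finrank_add_eq_of_isCompl hC'
  let e1 : U ≃ₗ[F] U' := LinearEquiv.ofFinrankEq _ _ h
  let e2 : C ≃ₗ[F] C' := LinearEquiv.ofFinrankEq _ _ (by omega)
  let Ψ : V ≃ₗ[F] V := (Submodule.prodEquivOfIsCompl U C hC).symm.trans
    ((e1.prodCongr e2).trans (Submodule.prodEquivOfIsCompl U' C' hC'))
  have h3 : ∀ v ∈ U, Ψ v ∈ U' := by
    intro v hv
    have : (Submodule.prodEquivOfIsCompl U C hC).symm v = (⟨v, hv⟩, 0) :=
      Submodule.prodEquivOfIsCompl_symm_apply_left U C hC ⟨v, hv⟩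
    simp [Ψ, this]
  have h4 : U.map Ψ.toLinearMap = U' := by
    apply Submodule.eq_of_le_of_finrank_eq
    · rintro _ ⟨v, hv, rfl⟩; exact h3 v hv
    · rw [← h]; exact LinearEquiv.finrank_map_eq Ψ U
  refine ⟨Ψ, fun v => ⟨fun hv => ?_, h3 v⟩⟩
  rw [← h4] at hv
  obtain ⟨w, hw, hw2⟩ := hv
  rwa [← Ψ.injective hw2]

lemma projPoint_smul {q n : ℕ} [Fact q.Prime] (v : Fin n → ZMod q) (c : ZMod q) (hc : c ≠ 0) :
    projPoint (c • v) = projPoint v :=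
  Submodule.span_singleton_smul_eq (IsUnit.mk0 c hc) v

lemma map_projPoint {q n : ℕ} (Ψ : (Fin n → ZMod q) ≃ₗ[ZMod q] (Fin n → ZMod q))
    (v : Fin n → ZMod q) : (projPoint v).map Ψ.toLinearMap = projPoint (Ψ v) := by
  simp [projPoint, Submodule.map_span]

lemma standard_space (q k : ℕ) (hq : q.Prime) (P : Finset ℕ)
    (pbar : Fin (k + 1) → ℕ) (hpbar : ∀ i, (pbar i).Prime) (hinj : Function.Injective pbar)
    (hP : ∀ i, pbar i ∈ P) :
    ∃ U : Submodule (ZMod q) (Fin P.card → ZMod q), Module.finrank (ZMod q) U = k + 1 ∧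
      (∀ t ∈ standardSet q k pbar, vecOf q P t ∈ U ∧ vecOf q P t ≠ 0) ∧
      ∀ w ∈ U, w ≠ 0 → ∃ t ∈ standardSet q k pbar, ∃ c : ZMod q, c ≠ 0 ∧ w = c • vecOf q P t := by
  classical
  have : Fact q.Prime := ⟨hq⟩
  have : NeZero q := ⟨hq.ne_zero⟩
  let Λ := Fintype.linearCombination (ZMod q) (fun j => vecOf q P (pbar j : ℤ))
  have hΛ : ∀ a, Λ a = ∑ j, a j • vecOf q P (pbar j : ℤ) := fun a => rfl
  have hev : ∀ a j, Λ a ((P.orderIsoOfFin rfl).symm ⟨pbar j, hP j⟩) = a j := by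
    intro a j
    rw [hΛ, Finset.sum_apply, Finset.sum_eq_single j]
    · simp [vecOf, (hpbar j).factorization_self]
    · intro b _ hbj
      simp only [vecOf, Pi.smul_apply, OrderIso.apply_symm_apply, Int.natAbs_natCast]
      rw [(hpbar b).factorization, Finsupp.single_eq_of_ne]
      · simp
      · intro h; exact hbj (hinj h.symm)
    · simp
  have hΛinj : Function.Injective Λ := by
    intro a b hab
    funext j
    rw [← hev a j, ← hev b j, hab]
  have hp0 : ∀ j, (pbar j : ℤ) ≠ 0 := fun j => by exact_mod_cast (hpbar j).ne_zero
  have hvec : ∀ (i : Fin (k + 1)) (α : Fin (k + 1) → Fin q),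
      vecOf q P ((pbar i : ℤ) *
        ∏ j ∈ Finset.univ.filter (fun j => i < j), (pbar j : ℤ) ^ (α j : ℕ)) =
      Λ (fun j => if j = i then 1 else if i < j then ((α j : ℕ) : ZMod q) else 0) := by
    intro i α
    rw [vecOf_mul _ _ _ _ (hp0 i) (prod_ne_zero_iff.2 fun j _ => pow_ne_zero _ (hp0 j)),
      vecOf_prod _ _ _ _ (fun j _ => pow_ne_zero _ (hp0 j)), hΛ, sum_filter,
      ← Finset.add_sum_erase univ _ (mem_univ i),
      ← Finset.add_sum_erase univ (fun j => (if j = i then (1 : ZMod q) else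
        if i < j then ((α j : ℕ) : ZMod q) else 0) • _) (mem_univ i)]
    simp only [lt_irrefl, if_false, zero_add, if_true, one_smul]
    congr 1
    refine sum_congr rfl fun j hj => ?_
    rw [if_neg (ne_of_mem_erase hj)]
    split_ifs
    · rw [vecOf_pow]
    · simp
  refine ⟨LinearMap.range Λ, ?_, ?_, ?_⟩
  · rw [LinearMap.finrank_range_of_inj hΛinj]; simp
  · intro t ht
    obtain ⟨⟨i, α⟩, -, rfl⟩ := mem_image.1 ht
    simp only
    rw [hvec]
    refine ⟨⟨_, rfl⟩, ?_⟩
    intro h0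
    have := hΛinj (h0.trans (map_zero Λ).symm)
    have := congrFun this i
    simp at this
  · rintro w ⟨a, rfl⟩ hw
    have ha : (univ.filter fun j => a j ≠ 0).Nonempty := by
      by_contra hne
      rw [Finset.not_nonempty_iff_eq_empty, filter_eq_empty_iff] at hne
      apply hw
      have : a = 0 := by funext j; simpa using hne (mem_univ j)
      rw [this, map_zero]
    set i := (univ.filter fun j => a j ≠ 0).min' ha with hi
    have hai : a i ≠ 0 := (mem_filter.1 (min'_mem _ ha)).2
    have hlt : ∀ j, j < i → a j = 0 := by
      intro j hj
      by_contra hne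
      exact absurd (min'_le _ j (mem_filter.2 ⟨mem_univ _, hne⟩)) (not_le.2 hj)
    let α : Fin (k + 1) → Fin q := fun j => ⟨(a j / a i).val, ZMod.val_lt _⟩
    refine ⟨_, mem_image.2 ⟨(i, α), mem_univ _, rfl⟩, a i, hai, ?_⟩
    simp only
    rw [hvec, ← map_smul]
    congr 1
    funext j
    simp only [Pi.smul_apply, smul_eq_mul]
    rcases lt_trichotomy j i with h | h | h
    · rw [if_neg h.ne, if_neg h.le.not_gt, hlt j h, mul_zero]
    · rw [if_pos h, h, mul_one]
    · rw [if_neg h.ne', if_pos h]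
      simp only [α, ZMod.natCast_val, ZMod.cast_id', id_eq]
      field_simp
end Geometry

/-- **Proposition (classification, second part).** A set `S ∈ 𝒯_{k,q}` of minimum size
`q^k + ⋯ + q + 1` containing no perfect `q`-th power is geometrically `q`-equivalent
to the standard set `S̄` built on any `k+1` distinct primes `p̄_1, …, p̄_{k+1}`. -/
theorem stmt11 (q k : ℕ) (hq : q.Prime) (hodd : Odd q) (hk : 1 ≤ k)
    (S : Finset ℤ) (hS0 : ∀ s ∈ S, s ≠ 0) (hSpow : ∀ s ∈ S, ¬ IsPerfectPow q s)
    (hcard : S.card = ∑ i ∈ Finset.range (k + 1), q ^ i)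
    (hS : MemT q k ↑S)
    (pbar : Fin (k + 1) → ℕ) (hpbar : ∀ i, (pbar i).Prime)
    (hpbarinj : Function.Injective pbar) :
    GeomEquiv q S (standardSet q k pbar) := by
  have : Fact q.Prime := ⟨hq⟩
  have : NeZero q := ⟨hq.ne_zero⟩
  unfold GeomEquiv
  set P := qPrimes q (S ∪ standardSet q k pbar) with hPdef
  have hv0 : ∀ s ∈ S, vecOf q P s ≠ 0 := by
    intro s hs
    refine vecOf_ne_zero q hodd P s (hS0 s hs) (hSpow s hs) ?_
    intro p hp hn
    exact (mem_qPrimes _ _ _).2 ⟨s, mem_union_left _ hs, hp, hn⟩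
  have hpP : ∀ i, pbar i ∈ P := by
    intro i
    refine (mem_qPrimes _ _ _).2 ⟨(pbar i : ℤ), mem_union_right _ ?_, ?_, ?_⟩
    · exact mem_image.2 ⟨(i, fun _ => ⟨0, hq.pos⟩), mem_univ _, by simp⟩
    · simp [(hpbar i).primeFactors]
    · simp [(hpbar i).factorization_self, hq.ne_one]
  obtain ⟨U, hU1, hU2, hU3⟩ := bb_main (q := q) (vecOf q P) k S hv0 hcard
    (fun fs hfs => exists_list_blocking q k hq S hS0 hS P fs hfs)
  obtain ⟨U', hU1', hU2', hU3'⟩ := standard_space q k hq P pbar hpbar hpbarinj hpP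
  obtain ⟨Ψ, hΨ⟩ := exists_equiv_map U U' (hU1.trans hU1'.symm)
  refine ⟨Ψ, ?_⟩
  ext Q
  constructor
  · rintro ⟨_, ⟨s, hs, rfl⟩, rfl⟩
    obtain ⟨t, ht, c, hc, h⟩ := hU3' (Ψ (vecOf q P s)) ((hΨ _).2 (hU2 s hs)) (by
      simpa using hv0 s hs)
    exact ⟨t, ht, by rw [map_projPoint, h, projPoint_smul _ _ hc]⟩
  · rintro ⟨t, ht, rfl⟩
    have h1 : Ψ.symm (vecOf q P t) ∈ U := by
      rw [← hΨ, LinearEquiv.apply_symm_apply]; exact (hU2' t ht).1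
    obtain ⟨s, hs, c, hc, h⟩ := hU3 _ h1 (by simpa using (hU2' t ht).2)
    refine ⟨_, ⟨s, hs, rfl⟩, ?_⟩
    rw [map_projPoint, ← projPoint_smul (Ψ (vecOf q P s)) c hc, ← map_smul, ← h,
      LinearEquiv.apply_symm_apply]
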